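/- Let X be a subset of P^n(F_q) and let d be the least positive integer such that |X| ≤ q + q^2 + ... + q^d. Then there exists a homogeneous polynomial f ∈ F_q[x_0,...,x_n] of degree at most d with f(p) ≠ 0 for every p ∈ X. -/

import Mathlib

open MvPolynomial

/-- The norm form of a finite extension, pulled back along a linear map. -/
theorem exists_isHomogeneous_eval_eq_norm {F K ι : Type*} [Field F] [Field K] [Algebra F K]
    [FiniteDimensional F K] [Fintype ι] (φ : (ι → F) →ₗ[F] K) :
    ∃ f : MvPolynomial ι F, f.IsHomogeneous (Module.finrank F K) ∧
      ∀ v, eval v f = Algebra.norm F (φ v) := by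
  classical
  let b := Module.finBasis F K
  let A : ι → Matrix (Fin (Module.finrank F K)) (Fin (Module.finrank F K)) F :=
    fun i ↦ Algebra.leftMulMatrix b (φ (Pi.single i 1))
  let M : Matrix (Fin (Module.finrank F K)) (Fin (Module.finrank F K)) (MvPolynomial ι F) :=
    Matrix.of fun j k ↦ ∑ i, C (A i j k) * X i
  refine ⟨M.det, ?_, fun v ↦ ?_⟩
  · rw [Matrix.det_apply']
    refine IsHomogeneous.sum _ _ _ fun σ _ ↦ ?_
    have hsign : (((σ.sign : ℤ) : MvPolynomial ι F)).IsHomogeneous 0 := by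
      rw [← map_intCast (C : F →+* MvPolynomial ι F)]
      exact isHomogeneous_C _ _
    have hprod := IsHomogeneous.prod Finset.univ (fun j ↦ M (σ j) j) (fun _ ↦ 1) fun j _ ↦
      IsHomogeneous.sum _ _ 1 fun i _ ↦ isHomogeneous_C_mul_X (A i (σ j) j) i
    simpa using hsign.mul hprod
  · rw [Algebra.norm_eq_matrix_det b, RingHom.map_det]
    congr 1
    have hv : φ v = ∑ i, v i • φ (Pi.single i 1) := by
      conv_lhs => rw [← Finset.univ_sum_single v]
      simp only [map_sum, ← map_smul]
      simp [← Pi.single_smul]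
    rw [hv]
    ext j k
    simp [M, A, Matrix.sum_apply, mul_comm]

/-- Over a finite field, the complement of a proper subspace of codimension `c` carries a
nonvanishing form of degree `c`. -/
theorem Submodule.exists_isHomogeneous_eval_ne_zero {F ι : Type*} [Field F] [Finite F] [Fintype ι]
    (W : Submodule F (ι → F)) (hW : 0 < Module.finrank F ((ι → F) ⧸ W)) :
    ∃ f : MvPolynomial ι F, f.IsHomogeneous (Module.finrank F ((ι → F) ⧸ W)) ∧
      ∀ v ∉ W, eval v f ≠ 0 := by
  obtain ⟨p, _⟩ := CharP.exists F
  have : Fact p.Prime := ⟨CharP.char_is_prime F p⟩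
  have : NeZero (Module.finrank F ((ι → F) ⧸ W)) := ⟨hW.ne'⟩
  have hK := FiniteField.finrank_extension F p (Module.finrank F ((ι → F) ⧸ W))
  let e := LinearEquiv.ofFinrankEq _ _ hK.symm
  obtain ⟨f, hf, hfv⟩ := exists_isHomogeneous_eval_eq_norm (e.toLinearMap ∘ₗ W.mkQ)
  refine ⟨f, hK ▸ hf, fun v hv ↦ ?_⟩
  rw [hfv, Algebra.norm_ne_zero_iff]
  simpa using hv

/-- A subspace that is maximal among those missing a finite set `X` of points has codimension
bounded in terms of the cardinality of `X`. -/
theorem Projectivization.exists_submodule_rep_notMem_card_le {F V : Type*} [Field F]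
    [AddCommGroup V] [Module F V] [FiniteDimensional F V] [Finite F]
    (X : Set (Projectivization F V)) :
    ∃ W : Submodule F V, (∀ x ∈ X, x.rep ∉ W) ∧
      ∑ i ∈ Finset.range (Module.finrank F (V ⧸ W)), Nat.card F ^ i ≤ Nat.card X := by
  have : Finite V := Module.finite_of_finite F
  have hbot : (⊥ : Submodule F V) ∈ {W : Submodule F V | ∀ x ∈ X, x.rep ∉ W} := fun x _ ↦ by
    simpa using x.rep_nonzero
  obtain ⟨W, hW, hmax⟩ := WellFounded.has_min
    (wellFounded_gt : WellFounded ((· > ·) : Submodule F V → Submodule F V → Prop)) _ ⟨⊥, hbot⟩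
  refine ⟨W, hW, ?_⟩
  rw [← Projectivization.card_of_finrank F (V ⧸ W) rfl]
  let g : X → Projectivization F (V ⧸ W) := fun x ↦
    Projectivization.mk F (W.mkQ x.1.rep) (by simpa using hW x.1 x.2)
  refine Nat.card_le_card_of_surjective g fun y ↦ ?_
  obtain ⟨v, hv⟩ := W.mkQ_surjective y.rep
  have hvW : v ∉ W := fun h ↦ y.rep_nonzero (by rw [← hv]; simpa using h)
  have hlt : W < W ⊔ Submodule.span F {v} := by
    refine lt_of_le_of_ne le_sup_left fun h ↦ hvW ?_
    rw [h]
    exact Submodule.mem_sup_right (Submodule.mem_span_singleton_self v)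
  have hnot : ¬ ∀ x ∈ X, x.rep ∉ W ⊔ Submodule.span F {v} := fun h ↦ hmax _ h hlt
  push Not at hnot
  obtain ⟨x, hx, hxW⟩ := hnot
  obtain ⟨w, hw, u, hu, hwu⟩ := Submodule.mem_sup.mp hxW
  obtain ⟨a, rfl⟩ := Submodule.mem_span_singleton.mp hu
  refine ⟨⟨x, hx⟩, ?_⟩
  rw [← y.mk_rep, Projectivization.mk_eq_mk_iff']
  refine ⟨a, ?_⟩
  rw [← hv, ← hwu, map_add, map_smul]
  simpa using hw

theorem stmt_8 (F : Type) [Field F] [Fintype F] (n : ℕ)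
    (X : Set (Projectivization F (Fin (n + 1) → F))) (d : ℕ) (hd : 0 < d)
    (hle : Nat.card X ≤ ∑ i ∈ Finset.Icc 1 d, (Fintype.card F) ^ i)
    (hleast : ∀ d', 0 < d' → Nat.card X ≤ ∑ i ∈ Finset.Icc 1 d', (Fintype.card F) ^ i → d ≤ d') :
    ∃ e ≤ d, 0 < e ∧ ∃ f : MvPolynomial (Fin (n + 1)) F, f ≠ 0 ∧ f.IsHomogeneous e ∧
      ∀ (v : Fin (n + 1) → F) (hv : v ≠ 0),
        Projectivization.mk F v hv ∈ X → eval v f ≠ 0 := by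
  obtain ⟨W, hW, hcard⟩ := Projectivization.exists_submodule_rep_notMem_card_le X
  have hXW : ∀ (v : Fin (n + 1) → F) (hv : v ≠ 0), Projectivization.mk F v hv ∈ X → v ∉ W := by
    intro v hv hvX hvW
    obtain ⟨a, ha⟩ := Projectivization.exists_smul_eq_mk_rep F v hv
    exact hW _ hvX (ha ▸ W.smul_mem (a : F) hvW)
  rcases Nat.eq_zero_or_pos (Module.finrank F ((Fin (n + 1) → F) ⧸ W)) with h0 | hpos
  · have hsub := Module.finrank_zero_iff.mp h0
    rw [Submodule.Quotient.subsingleton_iff] at hsub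
    refine ⟨1, hd, one_pos, MvPolynomial.X 0, X_ne_zero 0, isHomogeneous_X _ _, ?_⟩
    intro v hv hvX
    exact absurd (hsub ▸ Submodule.mem_top) (hXW v hv hvX)
  · obtain ⟨f, hf, hfv⟩ := W.exists_isHomogeneous_eval_ne_zero hpos
    refine ⟨_, ?_, hpos, f, ?_, hf, fun v hv hvX ↦ hfv v (hXW v hv hvX)⟩
    · by_contra! hlt
      have hsum : ∑ i ∈ Finset.range (d + 1), Fintype.card F ^ i
          = ∑ i ∈ Finset.Icc 1 d, Fintype.card F ^ i + 1 := by
        rw [Finset.range_eq_Ico, Finset.sum_eq_sum_Ico_succ_bot d.succ_pos, add_comm, pow_zero]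
        rfl
      have hmono : ∑ i ∈ Finset.range (d + 1), Fintype.card F ^ i
          ≤ ∑ i ∈ Finset.range (Module.finrank F ((Fin (n + 1) → F) ⧸ W)), Fintype.card F ^ i :=
        Finset.sum_le_sum_of_subset (Finset.range_mono hlt)
      rw [Nat.card_eq_fintype_card] at hcard
      omega
    · rintro rfl
      have htop : W ≠ ⊤ := by
        rw [Ne, ← Submodule.Quotient.subsingleton_iff]
        exact fun h ↦ hpos.ne' Module.finrank_zero_of_subsingleton
      obtain ⟨v, hv⟩ := SetLike.exists_not_mem_of_ne_top W htop rfl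
      exact hfv v hv (map_zero _)
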